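/- Let F be a properly parametrized Markov multi-map with forward trajectory space X (with left-shift map T) and associated SFT Σ_M. If Σ_M satisfies the Coding Condition (CC) and the Irreducibility Condition (IC), then (X,T) is topologically transitive and its periodic points are dense in X. -/

import Mathlib

open Set Topology

/-! ### Generic dynamical notions -/

/-- Topological transitivity of a map. -/
def TopTransitive {α : Type*} [TopologicalSpace α] (T : α → α) : Prop :=
  ∀ U V : Set α, IsOpen U → IsOpen V → U.Nonempty → V.Nonempty →
    ∃ n : ℕ, (T^[n] '' U ∩ V).Nonempty

/-- Topological mixing of a map. -/
def TopMixing {α : Type*} [TopologicalSpace α] (T : α → α) : Prop :=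
  ∀ U V : Set α, IsOpen U → IsOpen V → U.Nonempty → V.Nonempty →
    ∃ N : ℕ, ∀ n, N ≤ n → (T^[n] '' U ∩ V).Nonempty

/-- Density of the set of periodic points of a map. -/
def DensePeriodic {α : Type*} [TopologicalSpace α] (T : α → α) : Prop :=
  Dense {x : α | ∃ p : ℕ, 1 ≤ p ∧ T^[p] x = x}

/-- The metric `d(x,y) = sup_k |x_k - y_k|/(k+1)` on sequence spaces. -/
noncomputable def dseq (x y : ℕ → ℝ) : ℝ := ⨆ k : ℕ, |x k - y k| / ((k : ℝ) + 1)

/-- The specification property for a map `T` with respect to a distance function `d`. -/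
def SpecProp {α : Type*} (T : α → α) (d : α → α → ℝ) : Prop :=
  ∀ ε : ℝ, 0 < ε → ∃ N : ℕ, ∀ l : ℕ, ∀ x : Fin (l + 1) → α, ∀ a b : Fin (l + 1) → ℕ,
    (∀ k, 1 ≤ a k) → (∀ k, a k ≤ b k) →
    (∀ k : Fin l, b k.castSucc < a k.succ ∧ b k.castSucc + N ≤ a k.succ) →
    ∀ p : ℕ, b (Fin.last l) + N ≤ p →
      ∃ z : α, T^[p] z = z ∧
        ∀ k : Fin (l + 1), ∀ i : ℕ, a k ≤ i → i ≤ b k → d (T^[i] z) (T^[i] (x k)) < ε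

/-- The length `ℓ` of a (possibly degenerate) interval. -/
noncomputable def intervalLen (I : Set ℝ) : ℝ := sSup I - sInf I

/-! ### Markov multi-maps -/

/-- A Markov multi-map of the interval, given by a tuple
`(P, A₀, A₁, A₂, D, R, {f_a})` as in the paper, together with the derived data
(inverse maps `g`, interiors `D0`, `R0`, graphs `Gr`, `G0`) which are uniquely
determined by the defining equations below. -/
structure MarkovMultiMap where
  A : Type
  finA : Finite A
  A0 : Set A
  A1 : Set A
  A2 : Set A
  P : Finset ℝ
  D : A → Set ℝ
  R : A → Set ℝ
  f : A → ℝ → ℝ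
  g : A → ℝ → ℝ
  D0 : A → Set ℝ
  R0 : A → Set ℝ
  Gr : A → Set (ℝ × ℝ)
  G0 : A → Set (ℝ × ℝ)
  P_zero : (0 : ℝ) ∈ P
  P_one : (1 : ℝ) ∈ P
  P_sub : (P : Set ℝ) ⊆ Set.Icc 0 1
  A_cover : ∀ a : A, a ∈ A0 ∨ a ∈ A1 ∨ a ∈ A2
  A01 : A0 ∩ A1 = ∅
  A02 : A0 ∩ A2 = ∅
  A12 : A1 ∩ A2 = ∅
  D_A0 : ∀ a ∈ A0, ∃ p ∈ P, ∃ q ∈ P, p < q ∧ (∀ r ∈ P, ¬(p < r ∧ r < q)) ∧ D a = Set.Icc p q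
  D_A12 : ∀ a ∈ A1 ∪ A2, ∃ p ∈ P, D a = {p}
  R_A0 : ∀ a ∈ A0, ∃ u ∈ P, ∃ v ∈ P, u < v ∧ R a = Set.Icc u v
  R_A1 : ∀ a ∈ A1, ∃ u ∈ P, ∃ v ∈ P, u < v ∧ R a = Set.Icc u v ∧
    Set.Icc u v ∩ (P : Set ℝ) = {u, v}
  R_A2 : ∀ a ∈ A2, ∃ u ∈ P, R a = {u}
  f_homeo : ∀ a ∈ A0, ContinuousOn (f a) (D a) ∧ Set.BijOn (f a) (D a) (R a)
  g_A0 : ∀ a ∈ A0, (∀ x ∈ D a, g a (f a x) = x) ∧ ∀ y ∈ R a, g a y ∈ D a ∧ f a (g a y) = y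
  g_A12 : ∀ a ∈ A1 ∪ A2, ∀ y ∈ R a, g a y ∈ D a
  cover : Set.Icc (0 : ℝ) 1 = ⋃ a : A, D a
  D0_A0 : ∀ a ∈ A0, D0 a = interior (D a)
  D0_A12 : ∀ a ∈ A1 ∪ A2, D0 a = D a
  R0_A01 : ∀ a ∈ A0 ∪ A1, R0 a = interior (R a)
  R0_A2 : ∀ a ∈ A2, R0 a = R a
  Gr_A0 : ∀ a ∈ A0, Gr a = {q : ℝ × ℝ | q.1 ∈ D a ∧ q.2 = f a q.1}
  Gr_A12 : ∀ a ∈ A1 ∪ A2, Gr a = (D a) ×ˢ (R a)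
  G0_A0 : ∀ a ∈ A0, G0 a = {q : ℝ × ℝ | q.1 ∈ D0 a ∧ q.2 = f a q.1}
  G0_A1 : ∀ a ∈ A1, G0 a = (D a) ×ˢ (R0 a)
  G0_A2 : ∀ a ∈ A2, G0 a = Gr a

namespace MarkovMultiMap

variable (M : MarkovMultiMap)

/-- The graph `G(F)` of the multi-map. -/
def GF : Set (ℝ × ℝ) := ⋃ a : M.A, M.Gr a

/-- `F` is properly parametrized: the sets `G₀(a)` partition `G(F)`. -/
def ProperlyParametrized : Prop :=
  (⋃ a : M.A, M.G0 a) = M.GF ∧ ∀ a b : M.A, a ≠ b → Disjoint (M.G0 a) (M.G0 b)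

/-- The forward trajectory space `X`. -/
def X : Set (ℕ → ℝ) :=
  {x | (∀ k, x k ∈ Set.Icc (0 : ℝ) 1) ∧ ∀ k, (x k, x (k + 1)) ∈ M.GF}

/-- The left-shift map `T` on the forward trajectory space. -/
def shift : M.X → M.X :=
  fun x => ⟨fun k => x.1 (k + 1), ⟨fun k => x.2.1 (k + 1), fun k => x.2.2 (k + 1)⟩⟩

/-- The inverse trajectory (inverse limit) space `Y`, encoded by `y k = y_{-k}`. -/
def Y : Set (ℕ → ℝ) :=
  {y | (∀ k, y k ∈ Set.Icc (0 : ℝ) 1) ∧ ∀ k, (y (k + 1), y k) ∈ M.GF}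

/-- The right-shift map `S` on the inverse limit space (in the encoding `y k = y_{-k}`). -/
def ishift : M.Y → M.Y :=
  fun y => ⟨fun k => y.1 (k + 1), ⟨fun k => y.2.1 (k + 1), fun k => y.2.2 (k + 1)⟩⟩

/-- The space `X_n` of finite trajectories of length `n`. -/
def finTraj (n : ℕ) : Set (Fin n → ℝ) :=
  {x | (∀ i, x i ∈ Set.Icc (0 : ℝ) 1) ∧
    ∀ i : Fin n, ∀ h : (i : ℕ) + 1 < n, (x i, x ⟨(i : ℕ) + 1, h⟩) ∈ M.GF}

/-- The associated nearest-neighbor SFT `Σ_M`. -/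
def SFT : Set (ℕ → M.A) := {a | ∀ n : ℕ, M.D0 (a (n + 1)) ⊆ M.R0 (a n)}

/-- The word `u` (of length `n`) occurs in some point of `Z`. -/
def WordIn {n : ℕ} (u : Fin n → M.A) (Z : Set (ℕ → M.A)) : Prop :=
  ∃ z ∈ Z, ∃ m : ℕ, ∀ i : Fin n, u i = z (m + (i : ℕ))

/-- `L_n`, the words of length `n` in the language of `Σ_M`. -/
def Lang (n : ℕ) : Set (Fin n → M.A) := {u | M.WordIn u M.SFT}

/-- `(x,u)` is a labeled finite trajectory: `(x_k, x_{k+1}) ∈ G(u_k)` for all `k`. -/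
def Labeled {n : ℕ} (x : Fin (n + 1) → ℝ) (u : Fin n → M.A) : Prop :=
  ∀ i : Fin n, (x i.castSucc, x i.succ) ∈ M.Gr (u i)

/-- `(x,u)` is a special labeled finite trajectory: `(x_k, x_{k+1}) ∈ G₀(u_k)` for all `k`. -/
def SpecialLabeled {n : ℕ} (x : Fin (n + 1) → ℝ) (u : Fin n → M.A) : Prop :=
  ∀ i : Fin n, (x i.castSucc, x i.succ) ∈ M.G0 (u i)

/-- A word `u ∈ L_n` is essential if the set of finite trajectories specially labeled
by `u` is open in `X_{n+1}`. -/
def EssentialWord {n : ℕ} (u : Fin n → M.A) : Prop :=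
  u ∈ M.Lang n ∧ IsOpen {x : M.finTraj (n + 1) | M.SpecialLabeled x.1 u}

/-- A symbol is essential if it appears in some essential word. -/
def EssentialSymbol (a : M.A) : Prop :=
  ∃ n : ℕ, ∃ u : Fin n → M.A, M.EssentialWord u ∧ ∃ i : Fin n, u i = a

/-- `A^(e)`, the set of essential symbols. -/
def Ess : Set M.A := {a | M.EssentialSymbol a}

/-- `E`, the set of essential symbolic sequences. -/
def E : Set (ℕ → M.A) := {z ∈ M.SFT | ∀ i : ℕ, z i ∈ M.Ess}

/-- A word all of whose letters lie in `C`, in the language of `Σ_M`. -/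
def WordOver {n : ℕ} (u : Fin n → M.A) (C : Set M.A) : Prop :=
  u ∈ M.Lang n ∧ ∀ i, u i ∈ C

/-- There is a word of length `n+1` over `C` beginning with `a` and ending with `b`. -/
def WordFromTo (C : Set M.A) (a b : M.A) (n : ℕ) : Prop :=
  ∃ u : Fin (n + 1) → M.A, M.WordOver u C ∧ u 0 = a ∧ u (Fin.last n) = b

/-- `C ⊆ A` is irreducible. -/
def IrreducibleSet (C : Set M.A) : Prop :=
  ∀ a ∈ C, ∀ b ∈ C, ∃ n : ℕ, M.WordFromTo C a b n

/-- `C` is an irreducible component (a maximal irreducible subset of `A`). -/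
def IrreducibleComponent (C : Set M.A) : Prop :=
  M.IrreducibleSet C ∧ ∀ C' : Set M.A, M.IrreducibleSet C' → C ⊆ C' → C' = C

/-- `C ⊆ A` is mixing. -/
def MixingSet (C : Set M.A) : Prop :=
  ∃ N : ℕ, 1 ≤ N ∧ ∀ a ∈ C, ∀ b ∈ C, ∀ n : ℕ, N ≤ n + 1 → M.WordFromTo C a b n

/-- `C` is a mixing component (a maximal mixing subset of `A`). -/
def MixingComponent (C : Set M.A) : Prop :=
  M.MixingSet C ∧ ∀ C' : Set M.A, M.MixingSet C' → C ⊆ C' → C' = C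

/-- The Irreducibility Condition (IC). -/
def IC : Prop := ∃ C : Set M.A, M.IrreducibleComponent C ∧ M.Ess ⊆ C

/-- The Mixing Condition (MC). -/
def MC : Prop := ∃ C : Set M.A, M.MixingComponent C ∧ M.Ess ⊆ C

/-- `Z` is a subshift of `Σ_M`: shift-invariant and closed in the product of discrete
topologies (closedness phrased combinatorially). -/
def IsSubshift (Z : Set (ℕ → M.A)) : Prop :=
  Z ⊆ M.SFT ∧ (∀ z ∈ Z, (fun k => z (k + 1)) ∈ Z) ∧
  ∀ x : ℕ → M.A, (∀ n : ℕ, ∃ z ∈ Z, ∀ i, i < n → z i = x i) → x ∈ Z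

/-- The symbol `a` occurs in some point of `Z`. -/
def SymbolInShift (Z : Set (ℕ → M.A)) (a : M.A) : Prop := ∃ z ∈ Z, ∃ k : ℕ, z k = a

/-- `Z` is transitive on symbols. -/
def TransitiveOnSymbols (Z : Set (ℕ → M.A)) : Prop :=
  ∀ a b : M.A, M.SymbolInShift Z a → M.SymbolInShift Z b →
    ∃ z ∈ Z, ∃ m n : ℕ, z m = a ∧ z (m + n) = b

end MarkovMultiMap

/-- The composition `g_{u₀} ∘ ⋯ ∘ g_{u_n}` of inverse maps along a list of symbols. -/
def gWordList (M : MarkovMultiMap) : List M.A → ℝ → ℝ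
  | [], x => x
  | a :: l, x => M.g a (gWordList M l x)

namespace MarkovMultiMap

/-- The inverse map `g_u` associated to a word `u = u₀⋯u_n`. -/
def gWord (M : MarkovMultiMap) {n : ℕ} (u : Fin (n + 1) → M.A) : ℝ → ℝ :=
  gWordList M (List.ofFn u)

/-- The interval `I_u = g_u(R(u_n))`. -/
def Iword (M : MarkovMultiMap) {n : ℕ} (u : Fin (n + 1) → M.A) : Set ℝ :=
  M.gWord u '' M.R (u (Fin.last n))

/-- The Coding Condition (CC). -/
def CC (M : MarkovMultiMap) : Prop :=
  ∃ Z : Set (ℕ → M.A), M.IsSubshift Z ∧ M.TransitiveOnSymbols Z ∧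
    (∀ y ∈ Set.Icc (0 : ℝ) 1, ∃ a ∈ Z, ∃ x ∈ M.X, x 0 = y ∧
      ∀ i : ℕ, (x i, x (i + 1)) ∈ M.Gr (a i)) ∧
    (∀ ε : ℝ, 0 < ε → ∃ N : ℕ, ∀ n : ℕ, N ≤ n → ∀ u : Fin (n + 1) → M.A,
      M.WordIn u Z → intervalLen (M.Iword u) < ε)

/-- Uniform equicontinuity of the family `{g_u : u ∈ L(C)}`. -/
def UnifEquicontOn (M : MarkovMultiMap) (C : Set M.A) : Prop :=
  ∀ ε : ℝ, 0 < ε → ∃ δ : ℝ, 0 < δ ∧ ∀ n : ℕ, ∀ u : Fin (n + 1) → M.A, M.WordOver u C →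
    ∀ x ∈ M.R (u (Fin.last n)), ∀ y ∈ M.R (u (Fin.last n)),
      |x - y| < δ → |M.gWord u x - M.gWord u y| < ε

end MarkovMultiMap

namespace MarkovMultiMap

variable {M : MarkovMultiMap}

/-! ### Elementary geometry of the cells -/

lemma D_subset_Icc (a : M.A) : M.D a ⊆ Set.Icc 0 1 := by
  rw [M.cover]
  exact Set.subset_iUnion M.D a

lemma exists_R_eq_Icc (a : M.A) : ∃ u ∈ M.P, ∃ v ∈ M.P, u ≤ v ∧ M.R a = Set.Icc u v := by
  rcases M.A_cover a with h | h | h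
  · obtain ⟨u, hu, v, hv, huv, hR⟩ := M.R_A0 a h
    exact ⟨u, hu, v, hv, huv.le, hR⟩
  · obtain ⟨u, hu, v, hv, huv, hR, -⟩ := M.R_A1 a h
    exact ⟨u, hu, v, hv, huv.le, hR⟩
  · obtain ⟨u, hu, hR⟩ := M.R_A2 a h
    exact ⟨u, hu, u, hu, le_rfl, by rw [hR, Set.Icc_self]⟩

lemma R_subset_Icc (a : M.A) : M.R a ⊆ Set.Icc 0 1 := by
  obtain ⟨u, hu, v, hv, -, hR⟩ := exists_R_eq_Icc a
  rw [hR]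
  exact Set.Icc_subset_Icc (M.P_sub hu).1 (M.P_sub hv).2

lemma isClosed_R (a : M.A) : IsClosed (M.R a) := by
  obtain ⟨u, hu, v, hv, -, hR⟩ := exists_R_eq_Icc a
  rw [hR]
  exact isClosed_Icc

lemma R0_subset_R (a : M.A) : M.R0 a ⊆ M.R a := by
  rcases M.A_cover a with h | h | h
  · rw [M.R0_A01 a (Or.inl h)]
    exact interior_subset
  · rw [M.R0_A01 a (Or.inr h)]
    exact interior_subset
  · rw [M.R0_A2 a h]

lemma D_subset_closure_D0 (a : M.A) : M.D a ⊆ closure (M.D0 a) := by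
  by_cases h : a ∈ M.A0
  · obtain ⟨p, -, q, -, hpq, -, hD⟩ := M.D_A0 a h
    rw [M.D0_A0 a h, hD, interior_Icc, closure_Ioo hpq.ne]
  · rw [M.D0_A12 a ((M.A_cover a).resolve_left h)]
    exact subset_closure

lemma D_subset_R {a b : M.A} (h : M.D0 b ⊆ M.R0 a) : M.D b ⊆ M.R a :=
  (D_subset_closure_D0 b).trans
    (closure_minimal (h.trans (R0_subset_R a)) (isClosed_R a))

lemma not_mem_P_of_mem_D0 {a : M.A} (ha : a ∈ M.A0) {x : ℝ} (hx : x ∈ M.D0 a) : x ∉ M.P := by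
  obtain ⟨p, -, q, -, -, hP, hD⟩ := M.D_A0 a ha
  rw [M.D0_A0 a ha, hD, interior_Icc] at hx
  exact fun h => hP x h hx

lemma mem_P_of_mem_D {a : M.A} (ha : a ∉ M.A0) {x : ℝ} (hx : x ∈ M.D a) : x ∈ M.P := by
  obtain ⟨p, hp, hD⟩ := M.D_A12 a ((M.A_cover a).resolve_left ha)
  rw [hD] at hx
  rwa [Set.mem_singleton_iff.1 hx]

lemma mem_D0_of_not_mem_P {a : M.A} (ha : a ∈ M.A0) {x : ℝ} (hx : x ∈ M.D a) (hP : x ∉ M.P) :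
    x ∈ M.D0 a := by
  obtain ⟨p, hp, q, hq, -, -, hD⟩ := M.D_A0 a ha
  rw [hD] at hx
  rw [M.D0_A0 a ha, hD, interior_Icc]
  exact ⟨lt_of_le_of_ne hx.1 (by rintro rfl; exact hP hp),
    lt_of_le_of_ne hx.2 (by rintro rfl; exact hP hq)⟩

lemma not_mem_P_of_mem_R0 {a : M.A} (ha : a ∈ M.A1) {x : ℝ} (hx : x ∈ M.R0 a) : x ∉ M.P := by
  obtain ⟨u, hu, v, hv, -, hR, hP⟩ := M.R_A1 a ha
  rw [M.R0_A01 a (Or.inr ha), hR, interior_Icc] at hx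
  intro h
  have : x ∈ ({u, v} : Set ℝ) := by
    rw [← hP]
    exact ⟨⟨hx.1.le, hx.2.le⟩, h⟩
  rcases this with h | h
  · exact hx.1.ne' h
  · exact hx.2.ne h

lemma mem_R0_of_not_mem_P {a : M.A} {x : ℝ} (hx : x ∈ M.R a) (hP : x ∉ M.P) :
    x ∈ M.R0 a := by
  obtain ⟨u, hu, v, hv, -, hR⟩ := exists_R_eq_Icc a
  have hI : x ∈ interior (M.R a) := by
    rw [hR] at hx
    rw [hR, interior_Icc]
    exact ⟨lt_of_le_of_ne hx.1 (by rintro rfl; exact hP hu),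
      lt_of_le_of_ne hx.2 (by rintro rfl; exact hP hv)⟩
  rcases M.A_cover a with h | h | h
  · rwa [M.R0_A01 a (Or.inl h)]
  · rwa [M.R0_A01 a (Or.inr h)]
  · rwa [M.R0_A2 a h]

lemma isOpen_R0 {a : M.A} (ha : a ∉ M.A2) : IsOpen (M.R0 a) := by
  have h : a ∈ M.A0 ∪ M.A1 := by
    rcases M.A_cover a with h | h | h
    · exact Or.inl h
    · exact Or.inr h
    · exact absurd h ha
  rw [M.R0_A01 a h]
  exact isOpen_interior

lemma D0_subset_R0_of_mem {a b : M.A} {x : ℝ} (hb : x ∈ M.D0 b) (ha : x ∈ M.R0 a) :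
    M.D0 b ⊆ M.R0 a := by
  by_cases h : b ∈ M.A0
  · have hxP := not_mem_P_of_mem_D0 h hb
    obtain ⟨p, hp, q, hq, hpq, hP, hD⟩ := M.D_A0 b h
    obtain ⟨u, hu, v, hv, -, hR⟩ := exists_R_eq_Icc a
    have hxR := R0_subset_R a ha
    rw [hR] at hxR
    intro y hy
    refine mem_R0_of_not_mem_P ?_ (not_mem_P_of_mem_D0 h hy)
    rw [M.D0_A0 b h, hD, interior_Icc] at hb hy
    rw [hR]
    refine ⟨?_, ?_⟩
    · by_contra! hlt
      exact hP u hu ⟨lt_of_not_ge fun hle => by linarith [hy.1], by linarith [hxR.1, hb.2]⟩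
    · by_contra! hlt
      exact hP v hv ⟨by linarith [hxR.2, hb.1], by linarith [hy.2]⟩
  · rw [M.D0_A12 b ((M.A_cover b).resolve_left h)] at hb ⊢
    obtain ⟨p, hp, hD⟩ := M.D_A12 b ((M.A_cover b).resolve_left h)
    rw [hD] at hb ⊢
    rw [Set.singleton_subset_iff, ← Set.mem_singleton_iff.1 hb]
    exact ha

lemma D0_subset_R0_of_mem_D {a b : M.A} (h2 : a ∉ M.A2) {x : ℝ} (hb : x ∈ M.D b)
    (ha : x ∈ M.R0 a) : M.D0 b ⊆ M.R0 a := by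
  obtain ⟨y, hyR, hyD⟩ :=
    mem_closure_iff.1 (D_subset_closure_D0 b hb) (M.R0 a) (isOpen_R0 h2) ha
  exact D0_subset_R0_of_mem hyD hyR

/-! ### Graphs and inverse branches -/

lemma image_endpoint {p q u v : ℝ} {f : ℝ → ℝ} (hpq : p < q)
    (hf : ContinuousOn f (Set.Icc p q)) (hb : Set.BijOn f (Set.Icc p q) (Set.Icc u v))
    {x : ℝ} (hx : x ∈ Set.Icc p q) : x ∈ Set.Ioo p q ↔ f x ∈ Set.Ioo u v := by
  have hp : p ∈ Set.Icc p q := ⟨le_rfl, hpq.le⟩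
  have hq : q ∈ Set.Icc p q := ⟨hpq.le, le_rfl⟩
  have huv : u ≤ v := (hb.mapsTo hp).1.trans (hb.mapsTo hp).2
  obtain ⟨s, hs, hsu⟩ := hb.surjOn (show u ∈ Set.Icc u v from ⟨le_rfl, huv⟩)
  obtain ⟨t, ht, htv⟩ := hb.surjOn (show v ∈ Set.Icc u v from ⟨huv, le_rfl⟩)
  rcases hf.strictMonoOn_of_injOn_Icc' hpq.le hb.injOn with hm | hm
  · have h1 : f p = u := le_antisymm (hsu ▸ hm.monotoneOn hp hs hs.1) (hb.mapsTo hp).1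
    have h2 : f q = v := le_antisymm (hb.mapsTo hq).2 (htv ▸ hm.monotoneOn ht hq ht.2)
    rw [Set.mem_Ioo, Set.mem_Ioo, ← h1, ← h2, hm.lt_iff_lt hp hx, hm.lt_iff_lt hx hq]
  · have h1 : f p = v := le_antisymm (hb.mapsTo hp).2 (htv ▸ hm.antitoneOn hp ht ht.1)
    have h2 : f q = u := le_antisymm (hsu ▸ hm.antitoneOn hs hq hs.2) (hb.mapsTo hq).1
    rw [Set.mem_Ioo, Set.mem_Ioo, ← h1, ← h2, hm.lt_iff_gt hq hx, hm.lt_iff_gt hx hp, and_comm]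

lemma mem_D0_iff_mem_R0 {a : M.A} (ha : a ∈ M.A0) {x : ℝ} (hx : x ∈ M.D a) :
    x ∈ M.D0 a ↔ M.f a x ∈ M.R0 a := by
  obtain ⟨hc, hb⟩ := M.f_homeo a ha
  obtain ⟨p, -, q, -, hpq, -, hD⟩ := M.D_A0 a ha
  obtain ⟨u, -, v, -, -, hR⟩ := M.R_A0 a ha
  rw [M.D0_A0 a ha, M.R0_A01 a (Or.inl ha)]
  rw [hD] at hx hc hb ⊢
  rw [hR] at hb ⊢
  rw [interior_Icc, interior_Icc]
  exact image_endpoint hpq hc hb hx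

lemma D_eq_singleton {a : M.A} (ha : a ∉ M.A0) {x : ℝ} (hx : x ∈ M.D a) : M.D a = {x} := by
  obtain ⟨p, -, hD⟩ := M.D_A12 a ((M.A_cover a).resolve_left ha)
  rw [hD] at hx
  rw [hD, Set.mem_singleton_iff.1 hx]

lemma mem_Gr_iff {a : M.A} {x y : ℝ} : (x, y) ∈ M.Gr a ↔ y ∈ M.R a ∧ M.g a y = x := by
  by_cases ha : a ∈ M.A0
  · rw [M.Gr_A0 a ha]
    constructor
    · rintro ⟨hx, hy⟩
      simp only at hx hy
      subst hy
      exact ⟨(M.f_homeo a ha).2.mapsTo hx, (M.g_A0 a ha).1 x hx⟩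
    · rintro ⟨hy, rfl⟩
      exact ⟨((M.g_A0 a ha).2 y hy).1, ((M.g_A0 a ha).2 y hy).2.symm⟩
  · have h12 := (M.A_cover a).resolve_left ha
    rw [M.Gr_A12 a h12]
    constructor
    · rintro ⟨hx, hy⟩
      have h := M.g_A12 a h12 y hy
      rw [D_eq_singleton ha hx] at h
      exact ⟨hy, h⟩
    · rintro ⟨hy, rfl⟩
      exact ⟨M.g_A12 a h12 y hy, hy⟩

lemma g_mem_D {a : M.A} {y : ℝ} (hy : y ∈ M.R a) : M.g a y ∈ M.D a := by
  by_cases ha : a ∈ M.A0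
  · exact ((M.g_A0 a ha).2 y hy).1
  · exact M.g_A12 a ((M.A_cover a).resolve_left ha) y hy

lemma fst_mem_D {a : M.A} {x y : ℝ} (h : (x, y) ∈ M.Gr a) : x ∈ M.D a := by
  obtain ⟨hy, rfl⟩ := mem_Gr_iff.1 h
  exact g_mem_D hy

lemma Gr_subset_GF (a : M.A) : M.Gr a ⊆ M.GF := Set.subset_iUnion M.Gr a

lemma mem_G0_of_mem_R0 {a : M.A} {x y : ℝ} (h : (x, y) ∈ M.Gr a) (hy : y ∈ M.R0 a) :
    (x, y) ∈ M.G0 a := by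
  rcases M.A_cover a with ha | ha | ha
  · rw [M.Gr_A0 a ha] at h
    obtain ⟨hx, hxy⟩ := h
    simp only at hx hxy
    subst hxy
    rw [M.G0_A0 a ha]
    exact ⟨(mem_D0_iff_mem_R0 ha hx).2 hy, rfl⟩
  · rw [M.G0_A1 a ha]
    exact ⟨fst_mem_D h, hy⟩
  · rwa [M.G0_A2 a ha]

lemma of_mem_G0 {a : M.A} {x y : ℝ} (h : (x, y) ∈ M.G0 a) :
    (x, y) ∈ M.Gr a ∧ x ∈ M.D0 a ∧ y ∈ M.R0 a := by
  rcases M.A_cover a with ha | ha | ha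
  · rw [M.G0_A0 a ha] at h
    obtain ⟨hx, hxy⟩ := h
    simp only at hx hxy
    subst hxy
    have hxD : x ∈ M.D a := by
      rw [M.D0_A0 a ha] at hx
      exact interior_subset hx
    refine ⟨?_, hx, (mem_D0_iff_mem_R0 ha hxD).1 hx⟩
    rw [M.Gr_A0 a ha]
    exact ⟨hxD, rfl⟩
  · rw [M.G0_A1 a ha] at h
    refine ⟨?_, ?_, h.2⟩
    · rw [M.Gr_A12 a (Or.inl ha)]
      exact ⟨h.1, R0_subset_R a h.2⟩
    · rw [M.D0_A12 a (Or.inl ha)]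
      exact h.1
  · rw [M.G0_A2 a ha] at h
    refine ⟨h, ?_, ?_⟩
    · rw [M.D0_A12 a (Or.inr ha)]
      exact fst_mem_D h
    · rw [M.R0_A2 a ha]
      exact (mem_Gr_iff.1 h).1

lemma isClosed_D (a : M.A) : IsClosed (M.D a) := by
  by_cases ha : a ∈ M.A0
  · obtain ⟨p, -, q, -, -, -, hD⟩ := M.D_A0 a ha
    rw [hD]
    exact isClosed_Icc
  · obtain ⟨p, -, hD⟩ := M.D_A12 a ((M.A_cover a).resolve_left ha)
    rw [hD]
    exact isClosed_singleton

lemma isCompact_D (a : M.A) : IsCompact (M.D a) :=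
  isCompact_Icc.of_isClosed_subset (isClosed_D a) (D_subset_Icc a)

lemma continuousOn_g (a : M.A) : ContinuousOn (M.g a) (M.R a) := by
  by_cases ha : a ∈ M.A0
  · obtain ⟨hc, hb⟩ := M.f_homeo a ha
    rw [continuousOn_iff_isClosed]
    intro t ht
    refine ⟨M.f a '' (M.D a ∩ t), (((isCompact_D a).inter_right ht).image_of_continuousOn
      (hc.mono Set.inter_subset_left)).isClosed, ?_⟩
    ext y
    constructor
    · rintro ⟨hy, hyR⟩
      exact ⟨⟨M.g a y, ⟨g_mem_D hyR, hy⟩, ((M.g_A0 a ha).2 y hyR).2⟩, hyR⟩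
    · rintro ⟨⟨x, ⟨hx, hxt⟩, rfl⟩, hyR⟩
      refine ⟨?_, hyR⟩
      rwa [Set.mem_preimage, (M.g_A0 a ha).1 x hx]
  · obtain ⟨p, -, hD⟩ := M.D_A12 a ((M.A_cover a).resolve_left ha)
    refine (continuousOn_const (c := p)).congr fun y hy => ?_
    have h := g_mem_D hy
    rwa [hD] at h

lemma isClosed_Gr (a : M.A) : IsClosed (M.Gr a) := by
  by_cases ha : a ∈ M.A0
  · have h : M.Gr a = (fun x => (x, M.f a x)) '' M.D a := by
      rw [M.Gr_A0 a ha]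
      ext ⟨x, y⟩
      constructor
      · rintro ⟨hx, hy⟩
        exact ⟨x, hx, Prod.ext rfl hy.symm⟩
      · rintro ⟨z, hz, h⟩
        rw [Prod.mk.injEq] at h
        obtain ⟨rfl, rfl⟩ := h
        exact ⟨hz, rfl⟩
    rw [h]
    exact ((isCompact_D a).image_of_continuousOn
      (continuousOn_id.prodMk (M.f_homeo a ha).1)).isClosed
  · rw [M.Gr_A12 a ((M.A_cover a).resolve_left ha)]
    exact (isClosed_D a).prod (isClosed_R a)

/-- The last letter of a labelling is determined by a point of an open cell: a `G₀`-cell that is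
an arc meets the closed graph of no other symbol. -/
lemma eq_of_mem_G0_of_mem_Gr (hpp : M.ProperlyParametrized) {a b : M.A} (ha : a ∉ M.A2) {x y : ℝ}
    (h0 : (x, y) ∈ M.G0 a) (h : (x, y) ∈ M.Gr b) : b = a := by
  by_contra hne
  refine Set.disjoint_left.1 (hpp.2 b a hne) ?_ h0
  obtain ⟨-, hxD, hyR⟩ := of_mem_G0 h0
  by_cases ha0 : a ∈ M.A0
  · have hxP := not_mem_P_of_mem_D0 ha0 hxD
    by_cases hb : b ∈ M.A0
    · have hx := mem_D0_of_not_mem_P hb (fst_mem_D h) hxP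
      rw [M.Gr_A0 b hb] at h
      rw [M.G0_A0 b hb]
      exact ⟨hx, h.2⟩
    · exact absurd (mem_P_of_mem_D hb (fst_mem_D h)) hxP
  · have ha1 : a ∈ M.A1 := by
      rcases M.A_cover a with h | h | h
      exacts [absurd h ha0, h, absurd h ha]
    exact mem_G0_of_mem_R0 h
      (mem_R0_of_not_mem_P (mem_Gr_iff.1 h).1 (not_mem_P_of_mem_R0 ha1 hyR))

/-! ### Labelled trajectories -/

lemma exists_label (hpp : M.ProperlyParametrized) {x : ℕ → ℝ} (hx : x ∈ M.X) :
    ∃ c ∈ M.SFT, ∀ i, (x i, x (i + 1)) ∈ M.G0 (c i) := by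
  have h : ∀ i, ∃ a, (x i, x (i + 1)) ∈ M.G0 a := fun i => by
    have hi := hx.2 i
    rwa [← hpp.1, Set.mem_iUnion] at hi
  choose c hc using h
  exact ⟨c, fun n => D0_subset_R0_of_mem (of_mem_G0 (hc (n + 1))).2.1 (of_mem_G0 (hc n)).2.2, hc⟩

lemma shift_mem_SFT {c : ℕ → M.A} (hc : c ∈ M.SFT) (m : ℕ) : (fun k => c (m + k)) ∈ M.SFT :=
  fun n => hc (m + n)

/-- Follow `c` for `n` steps, then restart along `d`. -/
def splice {α : Type*} (c : ℕ → α) (n : ℕ) (d : ℕ → α) : ℕ → α :=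
  fun k => if k < n then c k else d (k - n)

lemma splice_of_lt {α : Type*} {c d : ℕ → α} {n k : ℕ} (h : k < n) : splice c n d k = c k :=
  if_pos h

lemma splice_add {α : Type*} (c d : ℕ → α) (n k : ℕ) : splice c n d (n + k) = d k := by
  simp [splice]

lemma splice_of_le {α : Type*} {c d : ℕ → α} {n k : ℕ} (hcd : c n = d 0) (h : k ≤ n) :
    splice c n d k = c k := by
  rcases h.lt_or_eq with h | rfl
  · exact splice_of_lt h
  · simpa [hcd] using splice_add c d k 0

lemma splice_step {α : Type*} {c d : ℕ → α} {n : ℕ} {r : α → α → Prop}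
    (hc : ∀ k, k + 1 < n → r (c k) (c (k + 1))) (hd : ∀ k, r (d k) (d (k + 1)))
    (hcd : ∀ k, k + 1 = n → r (c k) (d 0)) (k : ℕ) :
    r (splice c n d k) (splice c n d (k + 1)) := by
  rcases lt_trichotomy (k + 1) n with h | h | h
  · rw [splice_of_lt h, splice_of_lt (by omega)]
    exact hc k h
  · have h1 : splice c n d (k + 1) = d 0 := by
      rw [h]
      exact splice_add c d n 0
    rw [splice_of_lt (by omega), h1]
    exact hcd k h
  · obtain ⟨j, rfl⟩ : ∃ j, k = n + j := ⟨k - n, by omega⟩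
    rw [splice_add, add_assoc, splice_add]
    exact hd j

lemma splice_mem_SFT {c d : ℕ → M.A} (hc : c ∈ M.SFT) (hd : d ∈ M.SFT) {n : ℕ}
    (hcd : ∀ k, k + 1 = n → M.D0 (d 0) ⊆ M.R0 (c k)) : splice c n d ∈ M.SFT :=
  splice_step (r := fun a b => M.D0 b ⊆ M.R0 a) (fun k _ => hc k) hd hcd

lemma splice_mem_SFT_of_eq {c d : ℕ → M.A} (hc : c ∈ M.SFT) (hd : d ∈ M.SFT) {n : ℕ}
    (hcd : c n = d 0) : splice c n d ∈ M.SFT :=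
  splice_mem_SFT hc hd fun k hk => by
    subst hk
    rw [← hcd]
    exact hc k

lemma splice_mem_X {x y : ℕ → ℝ} {n : ℕ} (hx : ∀ k, k ≤ n → x k ∈ Set.Icc (0 : ℝ) 1)
    (hG : ∀ k, k < n → (x k, x (k + 1)) ∈ M.GF) (hy : y ∈ M.X) (h : x n = y 0) :
    splice x n y ∈ M.X := by
  refine ⟨fun k => ?_, fun k => splice_step (r := fun s t => (s, t) ∈ M.GF)
    (fun j hj => hG j (by omega)) hy.2 (fun j hj => ?_) k⟩
  · unfold splice
    split_ifs with hk
    · exact hx k hk.le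
    · exact hy.1 _
  · subst hj
    rw [← h]
    exact hG j (by omega)

/-- Pulling back along a word of the SFT, continuously in the last coordinate. -/
lemma exists_pullback {c : ℕ → M.A} (hc : c ∈ M.SFT) (n : ℕ) :
    ∃ h : ℝ → ℝ, ContinuousOn h (M.R (c n)) ∧ ∀ y ∈ M.R (c n), ∃ x : ℕ → ℝ,
      x 0 = h y ∧ x (n + 1) = y ∧ ∀ i ≤ n, (x i, x (i + 1)) ∈ M.Gr (c i) := by
  induction n generalizing c with
  | zero =>
    refine ⟨M.g (c 0), continuousOn_g _, fun y hy =>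
      ⟨fun k => if k = 0 then M.g (c 0) y else y, by simp, by simp, fun i hi => ?_⟩⟩
    obtain rfl : i = 0 := by omega
    simpa using mem_Gr_iff.2 ⟨hy, rfl⟩
  | succ n ih =>
    obtain ⟨h, hcont, hh⟩ := ih (c := fun k => c (k + 1)) (fun k => hc (k + 1))
    have hmaps : Set.MapsTo h (M.R (c (n + 1))) (M.R (c 0)) := by
      intro y hy
      obtain ⟨x, hx0, -, hx⟩ := hh y hy
      rw [← hx0]
      exact D_subset_R (hc 0) (fst_mem_D (hx 0 (Nat.zero_le n)))
    refine ⟨M.g (c 0) ∘ h, (continuousOn_g _).comp hcont hmaps, fun y hy => ?_⟩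
    obtain ⟨x, hx0, hxn, hx⟩ := hh y hy
    refine ⟨fun k => Nat.casesOn k (M.g (c 0) (h y)) x, rfl, hxn, fun i hi => ?_⟩
    cases i with
    | zero =>
      refine mem_Gr_iff.2 ⟨?_, ?_⟩
      · change x 0 ∈ _
        rw [hx0]
        exact hmaps hy
      · change M.g (c 0) (x 0) = M.g (c 0) (h y)
        rw [hx0]
    | succ i => exact hx i (by omega)

/-- A word of the SFT labels some trajectory. -/
lemma exists_labeled_mem_X (htot : ∀ y ∈ Set.Icc (0 : ℝ) 1, ∃ x ∈ M.X, x 0 = y)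
    {c : ℕ → M.A} (hc : c ∈ M.SFT) (n : ℕ) :
    ∃ x ∈ M.X, ∀ i ≤ n, (x i, x (i + 1)) ∈ M.Gr (c i) := by
  obtain ⟨h, -, hh⟩ := exists_pullback hc n
  obtain ⟨u, -, v, -, huv, hR⟩ := exists_R_eq_Icc (c n)
  have hu : u ∈ M.R (c n) := by
    rw [hR]
    exact ⟨le_rfl, huv⟩
  obtain ⟨x, -, hxn, hx⟩ := hh u hu
  obtain ⟨y, hy, hy0⟩ := htot u (R_subset_Icc _ hu)
  have heq : x (n + 1) = y 0 := hxn.trans hy0.symm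
  refine ⟨splice x (n + 1) y, splice_mem_X (fun k hk => ?_)
    (fun k hk => Gr_subset_GF _ (hx k (by omega))) hy heq, fun i hi => ?_⟩
  · rcases hk.lt_or_eq with hk | rfl
    · exact D_subset_Icc _ (fst_mem_D (hx k (by omega)))
    · rw [hxn]
      exact R_subset_Icc _ hu
  · rw [splice_of_le heq (by omega), splice_of_le heq (by omega)]
    exact hx i hi

/-- A closed word of the SFT labels a periodic trajectory. -/
lemma exists_periodic_labeled {c : ℕ → M.A} (hc : c ∈ M.SFT) {n : ℕ}
    (hcyc : M.D0 (c 0) ⊆ M.R0 (c n)) :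
    ∃ x ∈ M.X, (∀ k, x (n + 1 + k) = x k) ∧ ∀ i ≤ n, (x i, x (i + 1)) ∈ M.Gr (c i) := by
  obtain ⟨h, hcont, hh⟩ := exists_pullback hc n
  have hmaps : Set.MapsTo h (M.R (c n)) (M.R (c n)) := by
    intro y hy
    obtain ⟨x, hx0, -, hx⟩ := hh y hy
    rw [← hx0]
    exact D_subset_R hcyc (fst_mem_D (hx 0 (Nat.zero_le n)))
  obtain ⟨u, -, v, -, huv, hR⟩ := exists_R_eq_Icc (c n)
  obtain ⟨y, hy, hfix⟩ : ∃ y ∈ M.R (c n), h y = y := by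
    rw [hR] at hcont hmaps ⊢
    exact exists_mem_Icc_isFixedPt_of_mapsTo hcont huv hmaps
  obtain ⟨x, hx0, hxn, hx⟩ := hh y hy
  have hper : x (n + 1) = x 0 := by rw [hx0, hxn, hfix]
  have hmod : ∀ k, ((x (k % (n + 1)), x ((k + 1) % (n + 1))) : ℝ × ℝ) ∈
      M.Gr (c (k % (n + 1))) := by
    intro k
    have hlt : k % (n + 1) < n + 1 := Nat.mod_lt _ (Nat.succ_pos n)
    have hk := hx (k % (n + 1)) (by omega)
    rcases (show k % (n + 1) < n ∨ k % (n + 1) = n by omega) with h | h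
    · rwa [show (k + 1) % (n + 1) = k % (n + 1) + 1 by
        rw [← Nat.mod_add_mod, Nat.mod_eq_of_lt (by omega)]]
    · rw [show (k + 1) % (n + 1) = 0 by rw [← Nat.mod_add_mod, h, Nat.mod_self]]
      rwa [h, hper, ← h] at hk
  refine ⟨fun k => x (k % (n + 1)), ⟨fun k => D_subset_Icc _ (fst_mem_D (hmod k)),
    fun k => Gr_subset_GF _ (hmod k)⟩, fun k => by simp, fun i hi => ?_⟩
  have := hmod i
  rw [Nat.mod_eq_of_lt (show i < n + 1 by omega)] at this
  change (x (i % (n + 1)), x ((i + 1) % (n + 1))) ∈ M.Gr (c i)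
  rwa [Nat.mod_eq_of_lt (show i < n + 1 by omega)]

/-- Trajectories carrying the same word are close as soon as their last coordinates are. -/
lemma exists_delta_of_labeled (c : ℕ → M.A) (z : ℕ → ℝ) (n : ℕ)
    (hz : ∀ i < n, (z i, z (i + 1)) ∈ M.Gr (c i)) {ε : ℝ} (hε : 0 < ε) :
    ∃ δ > 0, ∀ x : ℕ → ℝ, (∀ i < n, (x i, x (i + 1)) ∈ M.Gr (c i)) → |x n - z n| < δ →
      ∀ k ≤ n, |x k - z k| < ε := by
  induction n with
  | zero =>
    refine ⟨ε, hε, fun x _ hx k hk => ?_⟩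
    obtain rfl : k = 0 := by omega
    exact hx
  | succ n ih =>
    obtain ⟨δ, hδ, hxδ⟩ := ih fun i hi => hz i (by omega)
    obtain ⟨hzR, hzg⟩ := mem_Gr_iff.1 (hz n (Nat.lt_succ_self n))
    obtain ⟨η, hη, hxη⟩ := Metric.continuousOn_iff.1 (continuousOn_g (c n)) _ hzR δ hδ
    refine ⟨min η ε, lt_min hη hε, fun x hx hlt k hk => ?_⟩
    rcases (show k ≤ n ∨ k = n + 1 by omega) with h | rfl
    · refine hxδ x (fun i hi => hx i (by omega)) ?_ k h
      obtain ⟨hxR, hxg⟩ := mem_Gr_iff.1 (hx n (Nat.lt_succ_self n))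
      have := hxη _ hxR (lt_of_lt_of_le hlt (min_le_left _ _))
      rwa [hxg, hzg] at this
    · exact lt_of_lt_of_le hlt (min_le_right _ _)

lemma gWordList_ofFn (a : ℕ → M.A) (x : ℕ → ℝ) (n : ℕ)
    (hx : ∀ i < n, (x i, x (i + 1)) ∈ M.Gr (a i)) :
    gWordList M (List.ofFn fun i : Fin n => a i) (x n) = x 0 := by
  induction n generalizing a x with
  | zero => simp [gWordList]
  | succ n ih =>
    have h := ih (fun k => a (k + 1)) (fun k => x (k + 1)) fun i hi => hx (i + 1) (by omega)
    simp only [List.ofFn_succ, gWordList, Fin.val_succ, Fin.val_zero]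
    rw [h]
    exact (mem_Gr_iff.1 (hx 0 (Nat.succ_pos n))).2

lemma mem_Iword_of_labeled (a : ℕ → M.A) (x : ℕ → ℝ) (n : ℕ)
    (hx : ∀ i ≤ n, (x i, x (i + 1)) ∈ M.Gr (a i)) :
    x 0 ∈ M.Iword (fun i : Fin (n + 1) => a i) :=
  ⟨x (n + 1), (mem_Gr_iff.1 (hx n le_rfl)).1, gWordList_ofFn a x (n + 1)
    fun i hi => hx i (by omega)⟩

lemma Iword_subset_Icc {a : ℕ → M.A} (ha : a ∈ M.SFT) (n : ℕ) :
    M.Iword (fun i : Fin (n + 1) => a i) ⊆ Set.Icc 0 1 := by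
  rintro _ ⟨y, hy, rfl⟩
  obtain ⟨h, -, hh⟩ := exists_pullback ha n
  obtain ⟨x, -, hxn, hx⟩ := hh y hy
  have := gWordList_ofFn a x (n + 1) fun i hi => hx i (by omega)
  rw [hxn] at this
  change gWordList M (List.ofFn fun i : Fin (n + 1) => a i) y ∈ _
  rw [this]
  exact D_subset_Icc _ (fst_mem_D (hx 0 (Nat.zero_le n)))

lemma abs_sub_le_intervalLen {I : Set ℝ} (hI : I ⊆ Set.Icc 0 1) {x y : ℝ} (hx : x ∈ I)
    (hy : y ∈ I) : |x - y| ≤ intervalLen I := by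
  have ha : BddAbove I := bddAbove_Icc.mono hI
  have hb : BddBelow I := bddBelow_Icc.mono hI
  have := le_csSup ha hx
  have := le_csSup ha hy
  have := csInf_le hb hx
  have := csInf_le hb hy
  unfold intervalLen
  rw [abs_le]
  constructor <;> linarith

/-! ### Essential words -/

/-- An admissible word whose closed cell meets the open cell of a word ending in an arc symbol
agrees with that word. -/
lemma word_eq_of_labeled (hpp : M.ProperlyParametrized) {c d : ℕ → M.A} {n : ℕ}
    (hd : ∀ i < n, M.D0 (d (i + 1)) ⊆ M.R0 (d i)) (hn : c n ∉ M.A2) {x : ℕ → ℝ}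
    (hc : ∀ i ≤ n, (x i, x (i + 1)) ∈ M.G0 (c i))
    (hx : ∀ i ≤ n, (x i, x (i + 1)) ∈ M.Gr (d i)) : ∀ i ≤ n, d i = c i := by
  intro i hi
  induction hi using Nat.decreasingInduction with
  | self => exact eq_of_mem_G0_of_mem_Gr hpp hn (hc n le_rfl) (hx n le_rfl)
  | of_succ k hk ih =>
    by_contra hne
    refine Set.disjoint_left.1 (hpp.2 _ _ hne) (mem_G0_of_mem_R0 (hx k hk.le) (hd k hk ?_))
      (hc k hk.le)
    rw [ih]
    exact (of_mem_G0 (hc (k + 1) hk)).2.1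

/-- Trajectories carrying the same word and having the same last coordinate coincide. -/
lemma eq_of_labeled {c : ℕ → M.A} {n : ℕ} {x y : ℕ → ℝ}
    (hx : ∀ i < n, (x i, x (i + 1)) ∈ M.Gr (c i))
    (hy : ∀ i < n, (y i, y (i + 1)) ∈ M.Gr (c i)) (h : x n = y n) : ∀ i ≤ n, x i = y i := by
  intro i hi
  induction hi using Nat.decreasingInduction with
  | self => exact h
  | of_succ k hk ih => rw [← (mem_Gr_iff.1 (hx k hk)).2, ← (mem_Gr_iff.1 (hy k hk)).2, ih]

lemma eq_of_labeled_of_mem_A2 {c : ℕ → M.A} {n : ℕ} (hn : c n ∈ M.A2) {x y : ℕ → ℝ}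
    (hx : ∀ i ≤ n, (x i, x (i + 1)) ∈ M.Gr (c i))
    (hy : ∀ i ≤ n, (y i, y (i + 1)) ∈ M.Gr (c i)) : ∀ i ≤ n + 1, x i = y i := by
  refine eq_of_labeled (fun i hi => hx i (by omega)) (fun i hi => hy i (by omega)) ?_
  obtain ⟨u, -, hR⟩ := M.R_A2 _ hn
  have h1 := (mem_Gr_iff.1 (hx n le_rfl)).1
  have h2 := (mem_Gr_iff.1 (hy n le_rfl)).1
  rw [hR] at h1 h2
  rw [Set.mem_singleton_iff.1 h1, Set.mem_singleton_iff.1 h2]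

/-- Every finite trajectory extends to an infinite one. -/
lemma exists_extension (htot : ∀ y ∈ Set.Icc (0 : ℝ) 1, ∃ x ∈ M.X, x 0 = y) {n : ℕ}
    (x : M.finTraj (n + 1)) : ∃ y ∈ M.X, ∀ i : Fin (n + 1), y i = x.1 i := by
  obtain ⟨t, ht, ht0⟩ := htot _ (x.2.1 (Fin.last n))
  let s : ℕ → ℝ := fun k => if h : k < n + 1 then x.1 ⟨k, h⟩ else 0
  have hs : ∀ k (h : k < n + 1), s k = x.1 ⟨k, h⟩ := fun k h => dif_pos h
  have hst : s n = t 0 := by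
    rw [ht0, hs n (Nat.lt_succ_self n)]
    rfl
  refine ⟨splice s n t, splice_mem_X (fun k hk => ?_) (fun k hk => ?_) ht hst, fun i => ?_⟩
  · rw [hs k (by omega)]
    exact x.2.1 _
  · rw [hs k (by omega), hs (k + 1) (by omega)]
    exact x.2.2 ⟨k, by omega⟩ (by simpa using hk)
  · rw [splice_of_le hst (by omega), hs i i.2]

lemma word_mem_Lang {c : ℕ → M.A} (hc : c ∈ M.SFT) (n : ℕ) :
    (fun i : Fin n => c i) ∈ M.Lang n :=
  ⟨c, hc, 0, fun i => by simp⟩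

lemma exists_of_mem_Lang {n : ℕ} {u : Fin n → M.A} (hu : u ∈ M.Lang n) :
    ∃ c ∈ M.SFT, ∀ i : Fin n, u i = c i := by
  obtain ⟨z, hz, m, h⟩ := hu
  exact ⟨_, shift_mem_SFT hz m, h⟩

/-- Words ending in an arc symbol are essential. -/
lemma essentialWord_of_not_mem_A2 (hpp : M.ProperlyParametrized)
    (htot : ∀ y ∈ Set.Icc (0 : ℝ) 1, ∃ x ∈ M.X, x 0 = y) {c : ℕ → M.A} (hc : c ∈ M.SFT)
    {n : ℕ} (hn : c n ∉ M.A2) : M.EssentialWord (fun i : Fin (n + 1) => c i) := by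
  refine ⟨word_mem_Lang hc _, ?_⟩
  have hfin := M.finA
  set u : Fin (n + 1) → M.A := fun i => c i with hu
  have hset : {x : M.finTraj (n + 1 + 1) | M.SpecialLabeled x.1 u} =
      ⋂ v ∈ {v : Fin (n + 1) → M.A | v ∈ M.Lang (n + 1) ∧ v ≠ u},
        {x : M.finTraj (n + 1 + 1) | M.Labeled x.1 v}ᶜ := by
    ext x
    obtain ⟨y, hy, hyx⟩ := exists_extension htot x
    have hcast : ∀ i : Fin (n + 1), ((x.1 i.castSucc, x.1 i.succ) : ℝ × ℝ) =
        (y i, y (i + 1)) := fun i => by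
      rw [← hyx, ← hyx]
      simp
    simp only [Set.mem_iInter, Set.mem_ofPred_eq, Set.mem_compl_iff]
    constructor
    · rintro hx v ⟨hv, hvu⟩ hxv
      obtain ⟨d, hd, hvd⟩ := exists_of_mem_Lang hv
      refine hvu (funext fun i => ?_)
      rw [hvd i]
      refine word_eq_of_labeled hpp (fun j _ => hd j) hn (x := y) (fun j hj => ?_)
        (fun j hj => ?_) i (by omega)
      · have := hx ⟨j, by omega⟩
        rwa [hcast] at this
      · have := hxv ⟨j, by omega⟩
        rwa [hcast, hvd] at this
    · intro hx
      obtain ⟨d, hd, hyd⟩ := exists_label hpp hy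
      have hdu : (fun i : Fin (n + 1) => d i) = u := by
        by_contra hne
        refine hx _ ⟨word_mem_Lang hd _, hne⟩ fun i => ?_
        rw [hcast]
        exact (of_mem_G0 (hyd i)).1
      intro i
      rw [hcast, ← hdu]
      exact hyd i
  rw [hset]
  refine (Set.toFinite _).isOpen_biInter fun v _ => isOpen_compl_iff.2 ?_
  have : {x : M.finTraj (n + 1 + 1) | M.Labeled x.1 v} =
      ⋂ i : Fin (n + 1), {x : M.finTraj (n + 1 + 1) |
        (x.1 i.castSucc, x.1 i.succ) ∈ M.Gr (v i)} := by
    ext x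
    simp [Labeled]
  rw [this]
  exact isClosed_iInter fun i => (isClosed_Gr (v i)).preimage
    (((continuous_apply _).comp continuous_subtype_val).prodMk
      ((continuous_apply _).comp continuous_subtype_val))

lemma mem_Ess_of_essentialWord {c : ℕ → M.A} {n : ℕ}
    (h : M.EssentialWord (fun i : Fin (n + 1) => c i)) : ∀ i ≤ n, c i ∈ M.Ess :=
  fun i hi => ⟨n + 1, _, h, ⟨i, by omega⟩, rfl⟩

/-- The symbols of the subshift in the Coding Condition are essential. -/
lemma mem_Ess_of_coding (hpp : M.ProperlyParametrized) {Z : Set (ℕ → M.A)} (hZ : Z ⊆ M.SFT)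
    (htr : M.TransitiveOnSymbols Z)
    (hcov : ∀ y ∈ Set.Icc (0 : ℝ) 1, ∃ a ∈ Z, ∃ x ∈ M.X, x 0 = y ∧
      ∀ i : ℕ, (x i, x (i + 1)) ∈ M.Gr (a i)) {a : ℕ → M.A} (ha : a ∈ Z) (k : ℕ) :
    a k ∈ M.Ess := by
  have htot : ∀ y ∈ Set.Icc (0 : ℝ) 1, ∃ x ∈ M.X, x 0 = y := fun y hy => by
    obtain ⟨-, -, x, hx, hx0, -⟩ := hcov y hy
    exact ⟨x, hx, hx0⟩
  obtain ⟨y, hy, hyP⟩ :=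
    (Set.Icc_infinite (zero_lt_one' ℝ)).exists_notMem_finset M.P
  obtain ⟨b, hb, x, -, hx0, hx⟩ := hcov y hy
  have hb0 : b 0 ∈ M.A0 := by
    by_contra h
    refine hyP (mem_P_of_mem_D h ?_)
    rw [← hx0]
    exact fst_mem_D (hx 0)
  obtain ⟨z, hz, m, n, hzm, hzn⟩ := htr (a k) (b 0) ⟨a, ha, k, rfl⟩ ⟨b, hb, 0, rfl⟩
  have hn : (fun j => z (m + j)) n ∉ M.A2 := by
    intro h
    change z (m + n) ∈ M.A2 at h
    rw [hzn] at h
    have : b 0 ∈ M.A0 ∩ M.A2 := ⟨hb0, h⟩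
    rw [M.A02] at this
    exact this
  have := mem_Ess_of_essentialWord (c := fun j => z (m + j))
    (essentialWord_of_not_mem_A2 hpp htot (shift_mem_SFT (hZ hz) m) hn) 0 (Nat.zero_le n)
  rwa [add_zero, hzm] at this

/-! ### Cylinders inside open sets -/

lemma exists_ball_subset {U : Set M.X} (hU : IsOpen U) {z : M.X} (hz : z ∈ U) :
    ∃ m : ℕ, ∃ ε > 0, ∀ x : M.X, (∀ k ≤ m, |x.1 k - z.1 k| < ε) → x ∈ U := by
  obtain ⟨V, hV, rfl⟩ := isOpen_induced_iff.1 hU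
  obtain ⟨I, u, hu, hsub⟩ := isOpen_pi_iff.1 hV z.1 hz
  have h : ∀ k ∈ I, ∃ ε > 0, Metric.ball (z.1 k) ε ⊆ u k := fun k hk =>
    Metric.isOpen_iff.1 (hu k hk).1 _ (hu k hk).2
  choose! r hr hball using h
  obtain ⟨ε, hε, hεr⟩ : ∃ ε > 0, ∀ k ∈ I, ε ≤ r k := by
    rcases I.eq_empty_or_nonempty with rfl | hI
    · exact ⟨1, one_pos, by simp⟩
    · obtain ⟨j, hj, hmin⟩ := I.exists_min_image r hI
      exact ⟨r j, hr j hj, hmin⟩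
  refine ⟨I.sup id, ε, hε, fun x hx => hsub fun k hk => hball k hk ?_⟩
  exact lt_of_lt_of_le (hx k (Finset.le_sup (f := id) hk)) (hεr k hk)

/-- Near every trajectory there is one whose initial word of a given length ends in an arc symbol,
unless the initial word of the given trajectory is already essential. -/
lemma exists_near_not_mem_A2 (hpp : M.ProperlyParametrized)
    (htot : ∀ y ∈ Set.Icc (0 : ℝ) 1, ∃ x ∈ M.X, x 0 = y) {z : ℕ → ℝ} (hz : z ∈ M.X)
    {c : ℕ → M.A} (hc : c ∈ M.SFT) (hzc : ∀ i, (z i, z (i + 1)) ∈ M.G0 (c i)) {n : ℕ}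
    (hn : c n ∈ M.A2) (hne : ¬ M.EssentialWord (fun i : Fin (n + 1) => c i)) {ε : ℝ}
    (hε : 0 < ε) :
    ∃ y ∈ M.X, ∃ d ∈ M.SFT, (∀ i, (y i, y (i + 1)) ∈ M.G0 (d i)) ∧ d n ∉ M.A2 ∧
      ∀ k ≤ n + 1, |y k - z k| < ε := by
  have hfin := M.finA
  let z' : M.finTraj (n + 1 + 1) := ⟨fun i => z i, fun i => hz.1 i, fun i _ => hz.2 i⟩
  have hset : {x : M.finTraj (n + 1 + 1) |
      M.SpecialLabeled x.1 (fun i : Fin (n + 1) => c i)} = {z'} := by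
    ext x
    simp only [Set.mem_ofPred_eq, Set.mem_singleton_iff]
    constructor
    · intro hx
      obtain ⟨y, hy, hyx⟩ := exists_extension htot x
      have hyc : ∀ i ≤ n, (y i, y (i + 1)) ∈ M.Gr (c i) := fun i hi => by
        have := (of_mem_G0 (hx ⟨i, by omega⟩)).1
        rw [← hyx, ← hyx] at this
        simpa using this
      have heq := eq_of_labeled_of_mem_A2 hn hyc fun i _ => (of_mem_G0 (hzc i)).1
      refine Subtype.ext (funext fun i => ?_)
      rw [← hyx i]
      exact heq i (by omega)
    · rintro rfl i
      simpa [z'] using hzc i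
  have hneBot : (𝓝[≠] z').NeBot := by
    refine ⟨fun hbot => hne ⟨word_mem_Lang hc _, ?_⟩⟩
    rw [hset]
    exact (isOpen_singleton_iff_punctured_nhds z').2 hbot
  have hW : {x : M.finTraj (n + 1 + 1) | ∀ i, |x.1 i - z'.1 i| < ε} ∈ 𝓝 z' := by
    refine IsOpen.mem_nhds ?_ (by simpa using hε)
    have : {x : M.finTraj (n + 1 + 1) | ∀ i, |x.1 i - z'.1 i| < ε} =
        ⋂ i, {x : M.finTraj (n + 1 + 1) | |x.1 i - z'.1 i| < ε} := by
      ext x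
      simp
    rw [this]
    exact isOpen_iInter_of_finite fun i => isOpen_lt
      (((continuous_apply i).comp continuous_subtype_val).sub continuous_const).abs
      continuous_const
  have hinf := infinite_of_mem_nhds z' hW
  have hext : ∀ x : M.finTraj (n + 1 + 1), ∃ y ∈ M.X, ∃ d ∈ M.SFT,
      (∀ i : Fin (n + 1 + 1), y i = x.1 i) ∧ ∀ i, (y i, y (i + 1)) ∈ M.G0 (d i) := fun x => by
    obtain ⟨y, hy, hyx⟩ := exists_extension htot x
    obtain ⟨d, hd, hyd⟩ := exists_label hpp hy
    exact ⟨y, hy, d, hd, hyx, hyd⟩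
  choose y hy d hd hyx hyd using hext
  obtain ⟨s, hs, t, -, hst, hdst⟩ := hinf.exists_ne_map_eq_of_mapsTo
    (f := fun x => fun i : Fin (n + 1) => d x i) (Set.mapsTo_univ _ _) Set.finite_univ
  refine ⟨y s, hy s, d s, hd s, hyd s, fun h2 => hst ?_, fun k hk => ?_⟩
  · have heq := eq_of_labeled_of_mem_A2 h2 (fun i _ => (of_mem_G0 (hyd s i)).1)
      (y := y t) fun i hi => by
        have : d s i = d t i := congrFun hdst ⟨i, by omega⟩
        rw [this]
        exact (of_mem_G0 (hyd t i)).1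
    refine Subtype.ext (funext fun i => ?_)
    rw [← hyx s i, ← hyx t i]
    exact heq i (by omega)
  · have := hs ⟨k, by omega⟩
    rwa [← hyx] at this

/-- Every nonempty open set of trajectories contains the closed cylinder of a word over the
essential symbols, of length at least two. -/
lemma exists_cylinder_subset (hpp : M.ProperlyParametrized) (hcc : M.CC) {U : Set M.X}
    (hU : IsOpen U) (hne : U.Nonempty) :
    ∃ c ∈ M.SFT, ∃ n ≥ 1, (∀ i ≤ n, c i ∈ M.Ess) ∧
      ∀ x : M.X, (∀ i ≤ n, (x.1 i, x.1 (i + 1)) ∈ M.Gr (c i)) → x ∈ U := by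
  obtain ⟨Z, ⟨hZ, -, -⟩, htr, hcov, hsmall⟩ := hcc
  have htot : ∀ y ∈ Set.Icc (0 : ℝ) 1, ∃ x ∈ M.X, x 0 = y := fun y hy => by
    obtain ⟨-, -, x, hx, hx0, -⟩ := hcov y hy
    exact ⟨x, hx, hx0⟩
  have hZess : ∀ a ∈ Z, ∀ k, a k ∈ M.Ess := fun a ha k => mem_Ess_of_coding hpp hZ htr hcov ha k
  obtain ⟨z, hz⟩ := hne
  obtain ⟨m, ε, hε, hball⟩ := exists_ball_subset hU hz
  obtain ⟨c, hc, hzc⟩ := exists_label hpp z.2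
  by_cases hess : c (m + 1) ∈ M.A2 ∧ M.EssentialWord (fun i : Fin (m + 1 + 1) => c i)
  · refine ⟨c, hc, m + 1, by omega, mem_Ess_of_essentialWord hess.2, fun x hx => hball x ?_⟩
    intro k hk
    rw [eq_of_labeled_of_mem_A2 hess.1 hx (fun i _ => (of_mem_G0 (hzc i)).1) k (by omega)]
    simpa using hε
  obtain ⟨y, hy, d, hd, hyd, hd2, hyz⟩ : ∃ y ∈ M.X, ∃ d ∈ M.SFT,
      (∀ i, (y i, y (i + 1)) ∈ M.G0 (d i)) ∧ d (m + 1) ∉ M.A2 ∧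
        ∀ k ≤ m + 1 + 1, |y k - z.1 k| < ε / 2 := by
    by_cases h2 : c (m + 1) ∈ M.A2
    · exact exists_near_not_mem_A2 hpp htot z.2 hc hzc h2 (fun h => hess ⟨h2, h⟩) (half_pos hε)
    · exact ⟨z.1, z.2, c, hc, hzc, h2, fun k _ => by simpa using half_pos hε⟩
  obtain ⟨δ, hδ, hδy⟩ := exists_delta_of_labeled d y (m + 2)
    (fun i _ => (of_mem_G0 (hyd i)).1) (half_pos hε)
  obtain ⟨a, ha, t, -, ht0, hta⟩ := hcov (y (m + 2)) (hy.1 _)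
  obtain ⟨N, hN⟩ := hsmall δ hδ
  have hlen := hN N le_rfl (fun i : Fin (N + 1) => a i) ⟨a, ha, 0, fun i => by simp⟩
  have hda : M.D0 (a 0) ⊆ M.R0 (d (m + 1)) := by
    refine D0_subset_R0_of_mem_D hd2 (x := y (m + 2)) ?_ (of_mem_G0 (hyd (m + 1))).2.2
    rw [← ht0]
    exact fst_mem_D (hta 0)
  have hdess := mem_Ess_of_essentialWord (essentialWord_of_not_mem_A2 hpp htot hd hd2)
  have hda' : ∀ k, k + 1 = m + 2 → M.D0 (a 0) ⊆ M.R0 (d k) := fun k hk => by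
    obtain rfl : k = m + 1 := by omega
    exact hda
  refine ⟨splice d (m + 2) a, splice_mem_SFT hd (hZ ha) hda', m + 2 + N, by omega,
    fun i hi => ?_, fun x hx => hball x fun k hk => ?_⟩
  · unfold splice
    split_ifs with h
    · exact hdess i (by omega)
    · exact hZess a ha _
  · have hxd : ∀ i < m + 2, (x.1 i, x.1 (i + 1)) ∈ M.Gr (d i) := fun i hi => by
      have := hx i (by omega)
      rwa [splice_of_lt hi] at this
    have hxa : ∀ i ≤ N, (x.1 (m + 2 + i), x.1 (m + 2 + (i + 1))) ∈ M.Gr (a i) := fun i hi => by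
      have := hx (m + 2 + i) (by omega)
      rwa [splice_add] at this
    have h1 := mem_Iword_of_labeled a (fun j => x.1 (m + 2 + j)) N hxa
    have h2 := mem_Iword_of_labeled a t N fun i _ => hta i
    rw [ht0] at h2
    have h3 := abs_sub_le_intervalLen (Iword_subset_Icc (hZ ha) N) h1 h2
    have h4 := hδy x.1 hxd (lt_of_le_of_lt h3 hlen) k (by omega)
    have h5 := hyz k (by omega)
    calc |x.1 k - z.1 k| ≤ |x.1 k - y k| + |y k - z.1 k| := abs_sub_le _ _ _
      _ < ε := by linarith

/-! ### Transitivity and periodic points -/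

lemma iterate_shift_apply (x : M.X) (n k : ℕ) : (M.shift^[n] x).1 k = x.1 (n + k) := by
  induction n generalizing x with
  | zero => simp
  | succ n ih =>
    rw [Function.iterate_succ_apply, ih]
    exact congrArg x.1 (show n + k + 1 = n + 1 + k by omega)

lemma exists_path {C : Set M.A} (hC : M.IrreducibleSet C) {a b : M.A} (ha : a ∈ C) (hb : b ∈ C) :
    ∃ d ∈ M.SFT, ∃ k, d 0 = a ∧ d k = b := by
  obtain ⟨k, u, ⟨hu, -⟩, h0, hk⟩ := hC a ha b hb
  obtain ⟨d, hd, hud⟩ := exists_of_mem_Lang hu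
  refine ⟨d, hd, k, ?_, ?_⟩
  · rw [← h0, hud]
    rfl
  · rw [← hk, hud]
    rfl

theorem topTransitive_shift (hpp : M.ProperlyParametrized) (hcc : M.CC) (hic : M.IC) :
    TopTransitive M.shift := by
  intro U V hU hV hUne hVne
  have htot : ∀ y ∈ Set.Icc (0 : ℝ) 1, ∃ x ∈ M.X, x 0 = y := fun y hy => by
    obtain ⟨Z, -, -, hcov, -⟩ := hcc
    obtain ⟨-, -, x, hx, hx0, -⟩ := hcov y hy
    exact ⟨x, hx, hx0⟩
  obtain ⟨C, ⟨hC, -⟩, hEss⟩ := hic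
  obtain ⟨c, hc, m, -, hcE, hcU⟩ := exists_cylinder_subset hpp hcc hU hUne
  obtain ⟨e, he, n, -, heE, heV⟩ := exists_cylinder_subset hpp hcc hV hVne
  obtain ⟨d, hd, k, hd0, hdk⟩ :=
    exists_path hC (hEss (hcE m le_rfl)) (hEss (heE 0 (Nat.zero_le n)))
  have hde := splice_mem_SFT_of_eq hd he hdk
  have hde0 : c m = splice d k e 0 := by
    rw [splice_of_le hdk (Nat.zero_le k), hd0]
  obtain ⟨x, hxX, hx⟩ := exists_labeled_mem_X htot (splice_mem_SFT_of_eq hc hde hde0) (m + (k + n))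
  refine ⟨m + k, M.shift^[m + k] ⟨x, hxX⟩, ⟨⟨x, hxX⟩, hcU _ fun i hi => ?_, rfl⟩,
    heV _ fun i hi => ?_⟩
  · have := hx i (by omega)
    rwa [splice_of_le hde0 hi] at this
  · have := hx (m + (k + i)) (by omega)
    rw [splice_add, splice_add] at this
    rw [iterate_shift_apply, iterate_shift_apply]
    simpa only [add_assoc] using this

theorem densePeriodic_shift (hpp : M.ProperlyParametrized) (hcc : M.CC) (hic : M.IC) :
    DensePeriodic M.shift := by
  refine dense_iff_inter_open.2 fun U hU hUne => ?_
  obtain ⟨C, ⟨hC, -⟩, hEss⟩ := hic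
  obtain ⟨c, hc, n, hn, hcE, hcU⟩ := exists_cylinder_subset hpp hcc hU hUne
  obtain ⟨d, hd, k, hd0, hdk⟩ : ∃ d ∈ M.SFT, ∃ k, d 0 = c n ∧ d (k + 1) = c 0 := by
    obtain ⟨d, hd, k, hd0, hdk⟩ :=
      exists_path hC (hEss (hcE n le_rfl)) (hEss (hcE 0 (Nat.zero_le n)))
    cases k with
    | zero =>
      have h : c n = c 0 := hd0.symm.trans hdk
      exact ⟨c, hc, n - 1, h.symm, by rw [Nat.sub_add_cancel hn, h]⟩
    | succ k => exact ⟨d, hd, k, hd0, hdk⟩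
  have hcd := splice_mem_SFT_of_eq hc hd hd0.symm
  have hcyc : M.D0 (splice c n d 0) ⊆ M.R0 (splice c n d (n + k)) := by
    rw [splice_of_lt hn, ← hdk, splice_add]
    exact hd k
  obtain ⟨x, hxX, hper, hx⟩ := exists_periodic_labeled hcd hcyc
  refine ⟨⟨x, hxX⟩, hcU _ fun i hi => ?_, n + k + 1, by omega, Subtype.ext (funext fun j => ?_)⟩
  · have := hx i (by omega)
    rwa [splice_of_le hd0.symm hi] at this
  · rw [iterate_shift_apply]
    exact hper j

end MarkovMultiMap

/-- If `Σ_M` satisfies the Coding Condition (CC) and the Irreducibility Condition (IC),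
then the forward trajectory system `(X,T)` is topologically transitive and its periodic
points are dense in `X`. -/
theorem stmt1 (M : MarkovMultiMap) (hpp : M.ProperlyParametrized)
    (hcc : M.CC) (hic : M.IC) :
    TopTransitive M.shift ∧ DensePeriodic M.shift := by
  exact ⟨MarkovMultiMap.topTransitive_shift hpp hcc hic,
    MarkovMultiMap.densePeriodic_shift hpp hcc hic⟩
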